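/- Let n = mℓ for positive integers m, ℓ. The total number of (m+2)-angulations of the once-punctured n-gon P_n^• equals C(n + ℓ - 1, ℓ). In particular (m = 1), the number of triangulations of P_n^• is C(2n - 1, n). -/

import Mathlib

/-- An arc on the once-punctured polygon `P_n^•`: either a spoke from boundary
vertex `i` to the puncture, or the peripheral arc from `i` clockwise to `j`
(cut off region without the puncture); `per i i` is the loop at `i` cutting out a
once-punctured monogon. -/
inductive PArc (n : ℕ) where
  | spoke (i : Fin n)
  | per (i j : Fin n)
deriving DecidableEq

namespace PArc

/-- Clockwise distance from `i` to `j` on the boundary. -/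
def gp (n : ℕ) (i j : Fin n) : ℕ := (j.val + n - i.val) % n

/-- The clockwise length of the peripheral arc from `i` to `j` (`n` for the loop). -/
def len (n : ℕ) (i j : Fin n) : ℕ := if i = j then n else (j.val + n - i.val) % n

/-- An arc is valid (not isotopic to a boundary segment). -/
def Valid {n : ℕ} : PArc n → Prop
  | .spoke _ => True
  | .per i j => 2 ≤ len n i j

/-- Two arcs cross (have essential intersection); computed via their lifts to the
universal cover (an infinite strip with vertices `ℤ`, a peripheral arc `per i j`
lifting to chords `(a, a + len i j)` for `a ≡ i (mod n)` and a spoke lifting to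
downward rays at positions `≡ i (mod n)`). -/
def Cross {n : ℕ} : PArc n → PArc n → Prop
  | .spoke _, .spoke _ => False
  | .spoke s, .per i j => 0 < gp n i s ∧ gp n i s < len n i j
  | .per i j, .spoke s => 0 < gp n i s ∧ gp n i s < len n i j
  | .per i j, .per k l =>
      (0 < gp n i k ∧ gp n i k < len n i j ∧ len n i j < gp n i k + len n k l) ∨
      (0 < gp n k i ∧ gp n k i < len n k l ∧ len n k l < gp n k i + len n i j)

def isSpoke {n : ℕ} : PArc n → Bool
  | .spoke _ => true
  | .per _ _ => false

end PArc

/-- `(a, b)` is a lift (to the strip with vertices `ℤ`) of a peripheral arc of `T`. -/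
def IsChord {n : ℕ} (T : Finset (PArc n)) (a b : ℤ) : Prop :=
  ∃ i j : Fin n, PArc.per i j ∈ T ∧ ∃ t : ℤ, a = (i.val : ℤ) + t * n ∧ b = a + PArc.len n i j

/-- `a` is the position of a lift of a spoke of `T`. -/
def IsRay {n : ℕ} (T : Finset (PArc n)) (a : ℤ) : Prop :=
  ∃ s : Fin n, PArc.spoke s ∈ T ∧ ∃ t : ℤ, a = (s.val : ℤ) + t * n

/-- `a` and `b` are joined by a boundary edge or a lifted chord. -/
def IsEdge {n : ℕ} (T : Finset (PArc n)) (a b : ℤ) : Prop :=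
  b = a + 1 ∨ IsChord T a b

/-- `a < b` are consecutive elements of `S`. -/
def ConsecIn (S : Finset ℤ) (a b : ℤ) : Prop :=
  a ∈ S ∧ b ∈ S ∧ a < b ∧ ∀ x ∈ S, ¬(a < x ∧ x < b)

/-- `S` is the vertex set of a finite face (a subgon not containing the puncture)
of the lift of `T` to the strip. -/
def IsFinFace {n : ℕ} (T : Finset (PArc n)) (S : Finset ℤ) : Prop :=
  3 ≤ S.card ∧
  (∀ u v : ℤ, ConsecIn S u v → IsEdge T u v) ∧
  (∃ a ∈ S, ∃ b ∈ S, (∀ x ∈ S, a ≤ x ∧ x ≤ b) ∧ IsChord T a b ∧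
    ∀ u ∈ S, ∀ v ∈ S, u < v → IsChord T u v → (u = a ∧ v = b) ∨ ConsecIn S u v)

/-- Vertex `x` of the strip is strictly covered by some lifted chord of `T`. -/
def Covered {n : ℕ} (T : Finset (PArc n)) (x : ℤ) : Prop :=
  ∃ a b : ℤ, IsChord T a b ∧ a < x ∧ x < b

/-- `T` is an `(m+2)`-angulation of the once-punctured polygon `P_n^•`: a set of
pairwise noncrossing valid arcs, containing a spoke, all of whose finite faces are
`(m+2)`-gons, and all of whose faces at the puncture (those between consecutive
spoke lifts, with the puncture as one extra vertex) are `(m+2)`-gons. -/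
def IsAngulation (n m : ℕ) (T : Finset (PArc n)) : Prop :=
  (∀ a ∈ T, PArc.Valid a) ∧
  (∀ a ∈ T, ∀ b ∈ T, a ≠ b → ¬ PArc.Cross a b) ∧
  (∃ s : Fin n, PArc.spoke s ∈ T) ∧
  (∀ S : Finset ℤ, IsFinFace T S → S.card = m + 2) ∧
  (∀ a b : ℤ, IsRay T a → IsRay T b → a < b → (∀ x : ℤ, a < x → x < b → ¬ IsRay T x) →
    Nat.card {x : ℤ // a ≤ x ∧ x ≤ b ∧ ¬ Covered T x} = m + 1)

/-- The number of spokes of `T`. -/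
def spokeCount {n : ℕ} (T : Finset (PArc n)) : ℕ := (T.filter (fun a => a.isSpoke)).card

/-- Counterclockwise rotation of arcs by `c` vertex positions (`v_i ↦ v_{i-c}`). -/
def rotArc {n : ℕ} (c : Fin n) : PArc n → PArc n
  | .spoke i => .spoke (i - c)
  | .per i j => .per (i - c) (j - c)



namespace PA

open Classical in
/-- number of chords starting at `a` and ending at or before `x` -/
noncomputable def cnt (C : ℤ → ℤ → Prop) (a x : ℤ) : ℕ := ((Finset.Icc a x).filter (C a)).card

def Good (C : ℤ → ℤ → Prop) (W : ℤ → ℤ) (m : ℕ) (a b : ℤ) : Prop :=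
  W b = W (a+1) + m * cnt C a b ∧ ∀ x, a < x → x < b → W x < W b

theorem vis_consec (I : ℤ → ℤ → Prop) (a b : ℤ)
    (hb : ∀ c d, I c d → a ≤ c ∧ d ≤ b)
    (nc : ∀ p q r s, I p q → I r s → ¬ (p < r ∧ r < q ∧ q < s))
    (S : Finset ℤ)
    (hS : ∀ x, x ∈ S ↔ a ≤ x ∧ x ≤ b ∧ ∀ c d, I c d → ¬ (c < x ∧ x < d))
    (u v : ℤ) (h : ConsecIn S u v) : v = u + 1 ∨ I u v := by
  obtain ⟨hu, hv, huv, hbt⟩ := h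
  by_cases h1 : v = u + 1
  · exact Or.inl h1
  right
  have hu' := (hS u).1 hu
  have hv' := (hS v).1 hv
  have h2 : u + 1 ∉ S := fun h => hbt _ h ⟨by omega, by omega⟩
  have h3 : ∃ d, I u d ∧ u + 1 < d := by
    by_contra hcon
    push Not at hcon
    apply h2
    rw [hS]
    refine ⟨by omega, by omega, ?_⟩
    rintro c d hcd ⟨h4, h5⟩
    have h6 := hu'.2.2 c d hcd
    have : c = u := by omega
    subst this
    have := hcon d hcd
    omega
  obtain ⟨d0, hd0⟩ := h3
  obtain ⟨d, ⟨hd, hd1⟩, hmax⟩ := Int.exists_greatest_of_bdd (P := fun d => I u d ∧ u + 1 < d)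
    ⟨b, fun z hz => (hb _ _ hz.1).2⟩ ⟨d0, hd0⟩
  have hdS : d ∈ S := by
    rw [hS]
    refine ⟨by omega, (hb _ _ hd).2, ?_⟩
    rintro c' d' hcd ⟨h4, h5⟩
    have h6 := hu'.2.2 c' d' hcd
    have h7 := nc _ _ _ _ hd hcd
    have : c' = u := by omega
    subst this
    have := hmax d' ⟨hcd, by omega⟩
    omega
  have h8 := hbt d hdS
  have h9 := hv'.2.2 _ _ hd
  have : d = v := by omega
  exact this ▸ hd

theorem exists_pred (S : Finset ℤ) (x a : ℤ) (ha : a ∈ S) (hax : a < x) :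
    ∃ u ∈ S, u < x ∧ ∀ y ∈ S, y < x → y ≤ u := by
  obtain ⟨u, hu, hm⟩ := (S.filter (· < x)).exists_max_image id ⟨a, by simp [ha, hax]⟩
  simp only [Finset.mem_filter, id] at hu hm
  exact ⟨u, hu.1, hu.2, fun y hy hyx => hm y ⟨hy, hyx⟩⟩

theorem exists_succ (S : Finset ℤ) (x b : ℤ) (hb : b ∈ S) (hxb : x ≤ b) :
    ∃ v ∈ S, x ≤ v ∧ ∀ y ∈ S, x ≤ y → v ≤ y := by
  obtain ⟨u, hu, hm⟩ := (S.filter (x ≤ ·)).exists_min_image id ⟨b, by simp [hb, hxb]⟩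
  simp only [Finset.mem_filter, id] at hu hm
  exact ⟨u, hu.1, hu.2, fun y hy hyx => hm y ⟨hy, hyx⟩⟩

theorem chain_count (S : Finset ℤ) (W : ℤ → ℤ) (p : ℤ) (hp : p ∈ S) (hmin : ∀ x ∈ S, p ≤ x)
    (h : ∀ u v, ConsecIn S u v → W v = W u + 1) :
    ∀ y ∈ S, W y = W p + (S.filter (· < y)).card := by
  have key : ∀ k : ℕ, ∀ y ∈ S, y ≤ p + k → W y = W p + (S.filter (· < y)).card := by
    intro k
    induction k with
    | zero =>
      intro y hy hk
      have : y = p := by have := hmin y hy; push_cast at hk; omega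
      subst this
      have : S.filter (· < y) = ∅ := by
        ext z; simp; intro hz; exact hmin z hz
      simp [this]
    | succ k ih =>
      intro y hy hk
      by_cases hyp : y = p
      · exact ih y hy (by omega)
      obtain ⟨u, hu, huy, hm⟩ := exists_pred S y p hp (by have := hmin y hy; omega)
      have h1 := h u y ⟨hu, hy, huy, fun x hx hh => by have := hm x hx hh.2; omega⟩
      have h2 := ih u hu (by push_cast at hk; omega)
      have h3 : S.filter (· < y) = insert u (S.filter (· < u)) := by
        ext z
        simp only [Finset.mem_filter, Finset.mem_insert]
        constructor
        · rintro ⟨hz, hzy⟩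
          have := hm z hz hzy
          by_cases hzu : z = u
          · exact Or.inl hzu
          · exact Or.inr ⟨hz, by omega⟩
        · rintro (rfl | ⟨hz, hzu⟩)
          · exact ⟨hu, huy⟩
          · exact ⟨hz, by omega⟩
      rw [h3, Finset.card_insert_of_notMem (by simp), h1, h2]
      push_cast; ring
  intro y hy
  exact key (y - p).toNat y hy (by have := hmin y hy; omega)

theorem chain_count' (S : Finset ℤ) (W : ℤ → ℤ) (p b : ℤ) (hp : p ∈ S) (hmin : ∀ x ∈ S, p ≤ x)
    (hb : b ∈ S) (hmax : ∀ x ∈ S, x ≤ b)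
    (h : ∀ u v, ConsecIn S u v → W v = W u + 1) :
    W b + 1 = W p + S.card ∧ ∀ y ∈ S, y < b → W y < W b := by
  have H := chain_count S W p hp hmin h
  constructor
  · rw [H b hb]
    have : S = insert b (S.filter (· < b)) := by
      ext z
      simp only [Finset.mem_filter, Finset.mem_insert]
      constructor
      · intro hz
        have := hmax z hz
        by_cases hzb : z = b
        · exact Or.inl hzb
        · exact Or.inr ⟨hz, by omega⟩
      · rintro (rfl | ⟨hz, hzu⟩)
        · exact hb
        · exact hz
    have h2 : S.card = (S.filter (· < b)).card + 1 := by
      conv_lhs => rw [this]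
      rw [Finset.card_insert_of_notMem (by simp)]
    rw [h2]; push_cast; ring
  · intro y hy hyb
    rw [H y hy, H b hb]
    have : (S.filter (· < y)).card < (S.filter (· < b)).card := by
      apply Finset.card_lt_card
      rw [Finset.ssubset_iff_of_subset]
      · exact ⟨y, by simp [hy, hyb], by simp⟩
      · intro z; simp only [Finset.mem_filter]; rintro ⟨h1, h2⟩; exact ⟨h1, by omega⟩
    omega

theorem cnt_eq (C : ℤ → ℤ → Prop) (a x y : ℤ) (h : ∀ z, C a z → a ≤ z → (z ≤ x ↔ z ≤ y)) :
    cnt C a x = cnt C a y := by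
  unfold cnt
  congr 1
  ext z
  simp only [Finset.mem_filter, Finset.mem_Icc]
  constructor
  · rintro ⟨⟨h1, h2⟩, h3⟩; exact ⟨⟨h1, (h z h3 h1).1 h2⟩, h3⟩
  · rintro ⟨⟨h1, h2⟩, h3⟩; exact ⟨⟨h1, (h z h3 h1).2 h2⟩, h3⟩

theorem cnt_succ (C : ℤ → ℤ → Prop) (a v b : ℤ) (hab : a ≤ b) (hC : C a b) (hvb : v < b)
    (h : ∀ z, C a z → z < b → z ≤ v) :
    cnt C a b = cnt C a v + 1 := by
  unfold cnt
  rw [← Finset.card_insert_of_notMem (a := b)]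
  · congr 1
    ext z
    simp only [Finset.mem_filter, Finset.mem_Icc, Finset.mem_insert]
    constructor
    · rintro ⟨⟨h1, h2⟩, h3⟩
      by_cases hz : z = b
      · exact Or.inl hz
      · exact Or.inr ⟨⟨h1, h z h3 (by omega)⟩, h3⟩
    · rintro (rfl | ⟨⟨h1, h2⟩, h3⟩)
      · exact ⟨⟨hab, le_rfl⟩, hC⟩
      · exact ⟨⟨h1, by omega⟩, h3⟩
  · simp; omega

theorem cnt_unit (C : ℤ → ℤ → Prop) (hlen : ∀ a b, C a b → a + 2 ≤ b) (a : ℤ) :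
    cnt C a (a+1) = 0 := by
  unfold cnt
  rw [Finset.card_eq_zero]
  ext z
  simp only [Finset.mem_filter, Finset.mem_Icc, Finset.notMem_empty, iff_false]
  rintro ⟨⟨h1, h2⟩, h3⟩
  have := hlen _ _ h3
  omega

/-- main chain lemma -/
theorem chain_lemma (C I : ℤ → ℤ → Prop) (W : ℤ → ℤ) (m N : ℕ) (a b : ℤ) (hab : a < b)
    (hlen : ∀ a b, C a b → a + 2 ≤ b ∧ b ≤ a + N)
    (hI1 : ∀ c d, C c d → a < c → c < b → d ≤ b → I c d)
    (S : Finset ℤ) (haS : a ∈ S) (hbS : b ∈ S) (hS : ∀ x ∈ S, a ≤ x ∧ x ≤ b)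
    (h1 : ∀ u v, ConsecIn S u v → v = u + 1 ∨ I u v)
    (h2 : ∀ x ∈ S, ∀ c d, I c d → ¬ (c < x ∧ x < d))
    (h3 : ∀ x ∈ S, a < x → x < b → ∀ y, C x y → y ≤ b)
    (hgood : ∀ c d, I c d → Good C W m c d)
    (hW : ∀ x ∈ S, a < x → x < b → W (x+1) = W x + 1 - m * cnt C x (x+N)) :
    ∃ v, ConsecIn S a v ∧ W b = W (a+1) + m * cnt C a v + S.card - 2 ∧
      ∀ x, a < x → x < b → W x < W b := by
  have hg : ∀ u v, ConsecIn S u v → Good C W m u v := by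
    intro u v h
    rcases h1 u v h with rfl | h
    · refine ⟨by rw [cnt_unit C (fun a b h => (hlen a b h).1)]; simp, fun x _ _ => by omega⟩
    · exact hgood _ _ h
  have hstep : ∀ u v, ConsecIn S u v → a < u → W v = W u + 1 := by
    intro u v h hau
    have hub : u < b := by have := hS v h.2.1; have := h.2.2.1; omega
    have e1 : cnt C u v = cnt C u (u+N) := by
      apply cnt_eq
      intro z hz _
      have := hlen _ _ hz
      refine ⟨fun _ => this.2, fun _ => ?_⟩
      have hi := hI1 _ _ hz hau hub (h3 u h.1 hau hub z hz)
      have := h2 v h.2.1 _ _ hi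
      have := h.2.2.1
      omega
    have := (hg u v h).1
    rw [this, hW u h.1 hau hub, e1]; ring
  obtain ⟨v, hv, hav, hvm⟩ := exists_succ S (a+1) b hbS (by omega)
  have hcv : ConsecIn S a v := ⟨haS, hv, by omega, fun x hx hh => by
    have := hvm x hx (by omega); omega⟩
  have hcons : ∀ u v, ConsecIn (S.erase a) u v → ConsecIn S u v ∧ a < u := by
    intro u v h
    obtain ⟨hu, hv, huv, hb⟩ := h
    rw [Finset.mem_erase] at hu hv
    have := (hS u hu.2).1
    refine ⟨⟨hu.2, hv.2, huv, fun x hx hh => hb x ?_ hh⟩, by omega⟩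
    rw [Finset.mem_erase]; exact ⟨by omega, hx⟩
  have hcc := chain_count' (S.erase a) W v b (by simp [hv]; omega)
    (by intro x hx; rw [Finset.mem_erase] at hx; have := hS x hx.2; exact hvm x hx.2 (by omega))
    (by simp [hbS]; omega) (fun x hx => (hS x (Finset.mem_of_mem_erase hx)).2)
    (fun u v h => hstep u v (hcons u v h).1 (hcons u v h).2)
  have hcard : (S.erase a).card + 1 = S.card := Finset.card_erase_add_one haS
  refine ⟨v, hcv, ?_, ?_⟩
  · have := (hg a v hcv).1
    have := hcc.1
    omega
  · intro x hax hxb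
    obtain ⟨w, hw, hxw, hwm⟩ := exists_succ S x b hbS (by omega)
    obtain ⟨u, hu, hux, hum⟩ := exists_pred S x a haS hax
    have hwb : W w ≤ W b := by
      by_cases h : w = b
      · rw [h]
      · exact (hcc.2 w (by simp [hw]; omega) (by have := hS w hw; omega)).le
    by_cases hxe : x = w
    · subst hxe
      exact hcc.2 x (by simp [hw]; omega) hxb
    · have hcw : ConsecIn S u w := ⟨hu, hw, by omega, fun y hy hh => by
        have := hwm y hy
        have := hum y hy
        omega⟩
      have := (hg u w hcw).2 x hux (by omega)
      omega

end PA

namespace PA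

structure Ok {n : ℕ} (T : Finset (PArc n)) : Prop where
  len : ∀ a b, IsChord T a b → a + 2 ≤ b ∧ b ≤ a + n
  nc : ∀ p q r s, IsChord T p q → IsChord T r s → ¬ (p < r ∧ r < q ∧ q < s)
  ray : ∀ x c d, IsRay T x → IsChord T c d → ¬ (c < x ∧ x < d)

open Classical in
/-- total number of arcs starting at (a lift) `x` -/
noncomputable def dg {n : ℕ} (T : Finset (PArc n)) (x : ℤ) : ℕ :=
  cnt (IsChord T) x (x+n) + if IsRay T x then 1 else 0

def Inn {n : ℕ} (T : Finset (PArc n)) (a b c d : ℤ) : Prop :=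
  IsChord T c d ∧ a ≤ c ∧ d ≤ b ∧ ¬ (c = a ∧ d = b)

/-- `S` is the vertex set of the face under chord `a b` -/
structure Face {n : ℕ} (T : Finset (PArc n)) (a b : ℤ) (S : Finset ℤ) : Prop where
  ch : IsChord T a b
  ha : a ∈ S
  hb : b ∈ S
  hS : ∀ x ∈ S, a ≤ x ∧ x ≤ b
  h1 : ∀ u v, ConsecIn S u v → v = u + 1 ∨ Inn T a b u v
  h2 : ∀ x ∈ S, ∀ c d, Inn T a b c d → ¬ (c < x ∧ x < d)

theorem Face.card {n : ℕ} {T : Finset (PArc n)} (ok : Ok T) {a b : ℤ} {S : Finset ℤ}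
    (F : Face T a b S) : 3 ≤ S.card := by
  have hab := ok.len _ _ F.ch
  by_cases h : ∃ x ∈ S, a < x ∧ x < b
  · obtain ⟨x, hx, h1, h2⟩ := h
    have : ({a, x, b} : Finset ℤ) ⊆ S := by
      intro y hy
      simp only [Finset.mem_insert, Finset.mem_singleton] at hy
      rcases hy with rfl | rfl | rfl
      · exact F.ha
      · exact hx
      · exact F.hb
    have h3 : ({a, x, b} : Finset ℤ).card = 3 := by
      rw [Finset.card_eq_three]
      exact ⟨a, x, b, by omega, by omega, by omega, rfl⟩
    rw [← h3]; exact Finset.card_le_card this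
  · push Not at h
    have := F.h1 a b ⟨F.ha, F.hb, by omega, fun x hx hh => by have := h x hx hh.1; omega⟩
    rcases this with h | h
    · omega
    · exact absurd ⟨rfl, rfl⟩ h.2.2.2

theorem Face.toFin {n : ℕ} {T : Finset (PArc n)} (ok : Ok T) {a b : ℤ} {S : Finset ℤ}
    (F : Face T a b S) : IsFinFace T S := by
  refine ⟨F.card ok, ?_, a, F.ha, b, F.hb, F.hS, F.ch, ?_⟩
  · intro u v h
    rcases F.h1 u v h with h | h
    · exact Or.inl h
    · exact Or.inr h.1
  · intro u hu v hv huv hc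
    by_cases he : u = a ∧ v = b
    · exact Or.inl he
    · right
      refine ⟨hu, hv, huv, fun x hx hh => ?_⟩
      exact F.h2 x hx u v ⟨hc, (F.hS u hu).1, (F.hS v hv).2, he⟩ hh

theorem face_of_fin {n : ℕ} {T : Finset (PArc n)} (ok : Ok T) {S : Finset ℤ}
    (h : IsFinFace T S) : ∃ a b, Face T a b S := by
  obtain ⟨hcard, hed, a, ha, b, hb, hS, hch, hin⟩ := h
  have hab := ok.len _ _ hch
  refine ⟨a, b, hch, ha, hb, hS, ?_, ?_⟩
  · intro u v h
    rcases hed u v h with h' | h'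
    · exact Or.inl h'
    · right
      refine ⟨h', (hS u h.1).1, (hS v h.2.1).2, ?_⟩
      rintro ⟨rfl, rfl⟩
      have : S ⊆ {u, v} := by
        intro x hx
        have h1 := hS x hx
        have h2 := h.2.2.2 x hx
        simp only [Finset.mem_insert, Finset.mem_singleton]
        omega
      have h3 := Finset.card_le_card this
      have h4 : ({u, v} : Finset ℤ).card ≤ 2 := Finset.card_le_two
      omega
  · rintro x hx c d ⟨hcd, hac, hdb, hne⟩ ⟨hcx, hxd⟩
    have hc : c ∈ S := by
      by_contra hc
      have hca : c ≠ a := fun h => hc (h ▸ ha)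
      obtain ⟨s, hs, hsc, hsm⟩ := exists_pred S c a ha (by omega)
      obtain ⟨t, ht, htc, htm⟩ := exists_succ S c x hx (by omega)
      have htc' : t ≠ c := fun h => hc (h ▸ ht)
      have htx := htm x hx (by omega)
      rcases hed s t ⟨hs, ht, by omega, fun y hy hh => by
        have := hsm y hy; have := htm y hy; omega⟩ with h | h
      · omega
      · exact ok.nc _ _ _ _ h hcd ⟨by omega, by omega, by omega⟩
    have hd : d ∈ S := by
      by_contra hd
      have hdb' : d ≠ b := fun h => hd (h ▸ hb)
      obtain ⟨s, hs, hsc, hsm⟩ := exists_pred S d x hx (by omega)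
      obtain ⟨t, ht, htc, htm⟩ := exists_succ S d b hb (by omega)
      have htc' : t ≠ d := fun h => hd (h ▸ ht)
      have hsx := hsm x hx (by omega)
      rcases hed s t ⟨hs, ht, by omega, fun y hy hh => by
        have := hsm y hy; have := htm y hy; omega⟩ with h | h
      · omega
      · exact ok.nc _ _ _ _ hcd h ⟨by omega, by omega, by omega⟩
    rcases hin c hc d hd (by omega) hcd with h | h
    · exact hne h
    · exact h.2.2.2 x hx ⟨hcx, hxd⟩

theorem exists_face {n : ℕ} {T : Finset (PArc n)} (ok : Ok T) {a b : ℤ}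
    (h : IsChord T a b) : ∃ S, Face T a b S := by
  classical
  have hab := ok.len _ _ h
  let S := (Finset.Icc a b).filter (fun x => ∀ c d, Inn T a b c d → ¬ (c < x ∧ x < d))
  have hS : ∀ x, x ∈ S ↔ a ≤ x ∧ x ≤ b ∧ ∀ c d, Inn T a b c d → ¬ (c < x ∧ x < d) := by
    intro x; simp only [S, Finset.mem_filter, Finset.mem_Icc]; tauto
  refine ⟨S, h, ?_, ?_, ?_, ?_, ?_⟩
  · rw [hS]; exact ⟨le_rfl, by omega, fun c d hi hh => by have := hi.2.1; omega⟩
  · rw [hS]; exact ⟨by omega, le_rfl, fun c d hi hh => by have := hi.2.2.1; omega⟩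
  · intro x hx; rw [hS] at hx; exact ⟨hx.1, hx.2.1⟩
  · intro u v huv
    exact vis_consec (Inn T a b) a b (fun c d h => ⟨h.2.1, h.2.2.1⟩)
      (fun p q r s h1 h2 => ok.nc _ _ _ _ h1.1 h2.1) S hS u v huv
  · intro x hx; rw [hS] at hx; exact hx.2.2

theorem fin_lemma {n : ℕ} {T : Finset (PArc n)} (ok : Ok T) {a b : ℤ} {S : Finset ℤ}
    (F : Face T a b S) (W : ℤ → ℤ) (m : ℕ)
    (hW : ∀ x, W (x+1) = W x + 1 - m * dg T x)
    (hg : ∀ c d, Inn T a b c d → Good (IsChord T) W m c d) :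
    W b = W (a+1) + m * ((cnt (IsChord T) a b : ℤ) - 1) + S.card - 2 ∧
      ∀ x, a < x → x < b → W x < W b := by
  have hab := ok.len _ _ F.ch
  obtain ⟨v, hv, h1, h2⟩ := chain_lemma (IsChord T) (Inn T a b) W m n a b (by omega) ok.len
    (fun c d h h1 h2 h3 => ⟨h, by omega, by omega, by omega⟩) S F.ha F.hb F.hS F.h1 F.h2
    (fun x hx h1 h2 y hy => by
      have := ok.nc _ _ _ _ F.ch hy
      omega) hg
    (fun x hx h1 h2 => by
      rw [hW x]
      have : ¬ IsRay T x := fun h => ok.ray _ _ _ h F.ch ⟨h1, h2⟩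
      simp [dg, this])
  refine ⟨?_, h2⟩
  have hvb : v ≠ b := by
    rintro rfl
    rcases F.h1 _ _ hv with h | h
    · omega
    · exact h.2.2.2 ⟨rfl, rfl⟩
  have := cnt_succ (IsChord T) a v b (by omega) F.ch (by have := F.hS v hv.2.1; omega)
    (fun z hz hzb => by
      have := F.h2 v hv.2.1 a z ⟨hz, le_rfl, by omega, by omega⟩
      have := hv.2.2.1
      omega)
  rw [h1, this]; push_cast; ring

theorem pun_lemma {n : ℕ} {T : Finset (PArc n)} (ok : Ok T) {a b : ℤ}
    (hab : a < b) (ha : IsRay T a) (hb : IsRay T b)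
    (hno : ∀ x : ℤ, a < x → x < b → ¬ IsRay T x) (W : ℤ → ℤ) (m : ℕ)
    (hW : ∀ x, W (x+1) = W x + 1 - m * dg T x)
    (hg : ∀ c d, IsChord T c d → Good (IsChord T) W m c d) :
    W b = W a - m - 1 + Nat.card {x : ℤ // a ≤ x ∧ x ≤ b ∧ ¬ Covered T x} ∧
      ∀ x, a < x → x < b → W x < W b := by
  classical
  let I : ℤ → ℤ → Prop := fun c d => IsChord T c d ∧ a ≤ c ∧ d ≤ b
  let S := (Finset.Icc a b).filter (fun x => ∀ c d, I c d → ¬ (c < x ∧ x < d))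
  have hS : ∀ x, x ∈ S ↔ a ≤ x ∧ x ≤ b ∧ ∀ c d, I c d → ¬ (c < x ∧ x < d) := by
    intro x; simp only [S, Finset.mem_filter, Finset.mem_Icc]; tauto
  have haS : a ∈ S := by
    rw [hS]; exact ⟨le_rfl, by omega, fun c d hi hh => by have := hi.2.1; omega⟩
  have hbS : b ∈ S := by
    rw [hS]; exact ⟨by omega, le_rfl, fun c d hi hh => by have := hi.2.2; omega⟩
  have hcard : Nat.card {x : ℤ // a ≤ x ∧ x ≤ b ∧ ¬ Covered T x} = S.card := by
    rw [← Nat.card_eq_finsetCard S]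
    apply Nat.card_congr
    apply Equiv.subtypeEquivRight
    intro x
    rw [hS]
    refine and_congr_right fun h1 => and_congr_right fun h2 => ?_
    constructor
    · intro h c d hi hh
      exact h ⟨c, d, hi.1, hh.1, hh.2⟩
    · rintro h ⟨c, d, hi, h3, h4⟩
      have := ok.ray _ _ _ ha hi
      have := ok.ray _ _ _ hb hi
      exact h c d ⟨hi, by omega, by omega⟩ ⟨h3, h4⟩
  obtain ⟨v, hv, h1, h2⟩ := chain_lemma (IsChord T) I W m n a b hab ok.len
    (fun c d h h1 h2 h3 => ⟨h, by omega, by omega⟩) S haS hbS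
    (fun x hx => by rw [hS] at hx; exact ⟨hx.1, hx.2.1⟩)
    (fun u v huv => vis_consec I a b (fun c d h => h.2)
      (fun p q r s h1 h2 => ok.nc _ _ _ _ h1.1 h2.1) S hS u v huv)
    (fun x hx => by rw [hS] at hx; exact hx.2.2)
    (fun x hx h1 h2 y hy => by
      have := ok.ray _ _ _ hb hy
      omega) (fun c d h => hg c d h.1)
    (fun x hx h1 h2 => by
      rw [hW x]
      simp [dg, hno x h1 h2])
  refine ⟨?_, h2⟩
  have e : cnt (IsChord T) a v = cnt (IsChord T) a (a+n) := by
    apply cnt_eq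
    intro z hz _
    have := ok.len _ _ hz
    refine ⟨fun _ => this.2, fun _ => ?_⟩
    have h3 := ok.ray _ _ _ hb hz
    have h4 := ((hS v).1 hv.2.1).2.2 a z ⟨hz, le_rfl, by omega⟩
    have := hv.2.2.1
    omega
  rw [h1, hW a, e, hcard]
  simp only [dg, ha, if_true]
  push_cast; ring

theorem good_of_ang {n : ℕ} {T : Finset (PArc n)} (ok : Ok T) (W : ℤ → ℤ) (m : ℕ)
    (hW : ∀ x, W (x+1) = W x + 1 - m * dg T x)
    (hfin : ∀ S : Finset ℤ, IsFinFace T S → S.card = m + 2) :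
    ∀ c d, IsChord T c d → Good (IsChord T) W m c d := by
  have key : ∀ k : ℕ, ∀ c d, IsChord T c d → d ≤ c + k → Good (IsChord T) W m c d := by
    intro k
    induction k with
    | zero =>
      intro c d h hk
      have := ok.len _ _ h
      push_cast at hk
      omega
    | succ k ih =>
      intro c d h hk
      obtain ⟨S, F⟩ := exists_face ok h
      have h1 := fin_lemma ok F W m hW (fun p q hpq => by
        obtain ⟨h3, h4, h5, h6⟩ := hpq
        apply ih p q h3
        push_cast at hk
        omega)
      refine ⟨?_, h1.2⟩
      rw [h1.1, hfin S (F.toFin ok)]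
      push_cast; ring
  intro c d h
  exact key (d - c).toNat c d h (by have := ok.len _ _ h; omega)

theorem card_of_good {n : ℕ} {T : Finset (PArc n)} (ok : Ok T) (W : ℤ → ℤ) (m : ℕ)
    (hW : ∀ x, W (x+1) = W x + 1 - m * dg T x)
    (hg : ∀ c d, IsChord T c d → Good (IsChord T) W m c d) (S : Finset ℤ)
    (h : IsFinFace T S) : S.card = m + 2 := by
  obtain ⟨a, b, F⟩ := face_of_fin ok h
  have h1 := fin_lemma ok F W m hW (fun p q hpq => hg p q hpq.1)
  have h2 := (hg a b F.ch).1
  have := h1.1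
  rw [mul_sub] at this
  omega

theorem ray_max {n : ℕ} (hn : 0 < n) {T : Finset (PArc n)} (W : ℤ → ℤ)
    (hper : ∀ x, IsRay T x → IsRay T (x + n))
    (hcon : ∀ a b, IsRay T a → IsRay T b → a < b → (∀ x : ℤ, a < x → x < b → ¬ IsRay T x) →
      W b = W a ∧ ∀ x, a < x → x < b → W x < W b)
    (r : ℤ) (hr : IsRay T r) : ∀ k : ℕ, W (r + k) ≤ W r ∧ (IsRay T (r+k) → W (r+k) = W r) := by
  intro k
  induction k using Nat.strong_induction_on with
  | _ k ih =>
    rcases Nat.eq_zero_or_pos k with rfl | hk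
    · simp
    -- previous ray
    obtain ⟨p, ⟨hp1, hp2⟩, hpm⟩ := Int.exists_greatest_of_bdd
      (P := fun p => IsRay T p ∧ p < r + k) ⟨r + k, fun z hz => hz.2.le⟩ ⟨r, hr, by omega⟩
    have hpr := hpm r ⟨hr, by omega⟩
    obtain ⟨q, ⟨hq1, hq2⟩, hqm⟩ := Int.exists_least_of_bdd
      (P := fun q => IsRay T q ∧ r + k ≤ q) ⟨r + k, fun z hz => hz.2⟩
      (by
        have : ∀ j : ℕ, IsRay T (r + j * n) := by
          intro j
          induction j with
          | zero => simpa using hr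
          | succ j ihj =>
            have := hper _ ihj
            push_cast
            rw [add_mul, ← add_assoc, one_mul]
            exact this
        refine ⟨r + k * n, this k, ?_⟩
        have : (k:ℤ) * 1 ≤ k * n := by
          apply mul_le_mul_of_nonneg_left <;> omega
        omega)
    have hc := hcon p q hp1 hq1 (by omega) (fun x h1 h2 hx => by
      have h3 := hpm x
      have h4 := hqm x
      by_cases h : x < r + k
      · have := h3 ⟨hx, h⟩; omega
      · have := h4 ⟨hx, by omega⟩; omega)
    have hpW : W p = W r := by
      have := (ih (p - r).toNat (by omega)).2
      have e : r + ((p - r).toNat : ℤ) = p := by omega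
      rw [e] at this
      exact this hp1
    have hcase : IsRay T (r+k) → W (r+k) = W r := by
      intro h
      have := hqm _ ⟨h, le_rfl⟩
      have e : q = r + k := by omega
      rw [← e, hc.1, hpW]
    refine ⟨?_, hcase⟩
    by_cases h : q = r + k
    · rw [hcase (h ▸ hq1)]
    · have := hc.2 (r+k) (by omega) (by omega)
      omega

end PA

namespace PA

/-- residue of an integer position -/
def res (n : ℕ) [NeZero n] (x : ℤ) : Fin n :=
  ⟨(x % n).toNat, by
    have h0 : 0 < n := Nat.pos_of_ne_zero (NeZero.ne n)
    have := Int.emod_lt_of_pos x (b := n) (by omega)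
    have := Int.emod_nonneg x (b := n) (by omega)
    omega⟩

section
set_option linter.unusedSectionVars false
variable {n : ℕ} [NeZero n]

theorem npos : 0 < n := Nat.pos_of_ne_zero (NeZero.ne n)

theorem res_val (x : ℤ) : ((res n x).val : ℤ) = x % n := by
  have h0 : 0 < n := npos
  have := Int.emod_nonneg x (b := n) (by omega)
  simp only [res]
  omega

theorem res_spec (x : ℤ) : x = (res n x).val + (x / n) * n := by
  rw [res_val]
  have := Int.emod_add_mul_ediv x n
  rw [mul_comm] at this
  exact this.symm

theorem res_of (i : Fin n) (t : ℤ) : res n ((i.val : ℤ) + t * n) = i := by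
  apply Fin.ext
  have h := res_val (n := n) ((i.val : ℤ) + t * n)
  rw [Int.add_mul_emod_self_right, Int.emod_eq_of_lt (by omega) (by have := i.2; omega)] at h
  exact_mod_cast h

theorem res_coe (i : Fin n) : res n (i.val : ℤ) = i := by
  have := res_of i 0
  simpa using this

theorem res_add (x : ℤ) (t : ℤ) : res n (x + t * n) = res n x := by
  apply Fin.ext
  have h := res_val (n := n) (x + t * n)
  rw [Int.add_mul_emod_self_right, ← res_val] at h
  exact_mod_cast h

theorem res_add_n (x : ℤ) : res n (x + n) = res n x := by
  have := res_add (n := n) x 1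
  simpa using this

theorem gp_cast (i j : Fin n) : (PArc.gp n i j : ℤ) = ((j.val : ℤ) - i.val) % n := by
  unfold PArc.gp
  have := i.2
  push_cast [Nat.cast_sub (show i.val ≤ j.val + n by omega)]
  rw [show (j.val : ℤ) + n - i.val = (j.val - i.val) + n by ring, Int.add_emod_right]

theorem gp_eq (a b : ℤ) (h1 : a ≤ b) (h2 : b < a + n) :
    (PArc.gp n (res n a) (res n b) : ℤ) = b - a := by
  rw [gp_cast, res_val, res_val, ← Int.sub_emod]
  exact Int.emod_eq_of_lt (by omega) (by omega)

theorem len_eq (a b : ℤ) (h1 : a < b) (h2 : b ≤ a + n) :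
    (PArc.len n (res n a) (res n b) : ℤ) = b - a := by
  unfold PArc.len
  by_cases h : b = a + n
  · subst h
    rw [res_add_n]
    simp
  · have hg := gp_eq (n := n) a b (by omega) (by omega)
    split_ifs with hij
    · rw [hij, gp_cast] at hg
      simp at hg
      omega
    · exact hg

theorem gp_lt (i j : Fin n) : PArc.gp n i j < n := Nat.mod_lt _ npos

theorem res_gp (a : ℤ) (j : Fin n) : res n (a + PArc.gp n (res n a) j) = j := by
  have h := res_spec (n := n) a
  rw [gp_cast, Int.emod_def]
  have e : a + ((j.val : ℤ) - (res n a).val - n * (((j.val : ℤ) - (res n a).val) / n))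
      = j.val + (a / n - ((j.val : ℤ) - (res n a).val) / n) * n := by
    rw [sub_mul]
    linarith
  rw [e, res_of]

theorem len_cases (i j : Fin n) : (i = j ∧ PArc.len n i j = n) ∨
    (i ≠ j ∧ PArc.len n i j = PArc.gp n i j) := by
  unfold PArc.len
  split_ifs with h
  · exact Or.inl ⟨h, rfl⟩
  · exact Or.inr ⟨h, rfl⟩

theorem len_le (i j : Fin n) : PArc.len n i j ≤ n := by
  rcases len_cases i j with h | h
  · omega
  · have := gp_lt i j; omega

theorem len_pos (i j : Fin n) : 0 < PArc.len n i j := by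
  have h0 : 0 < n := npos
  rcases len_cases i j with h | h
  · omega
  · by_contra hc
    have h1 : PArc.gp n i j = 0 := by omega
    have h2 := res_gp (n := n) (i.val : ℤ) j
    rw [res_coe, h1] at h2
    simp [res_coe] at h2
    exact h.1 h2

theorem res_len (a : ℤ) (j : Fin n) : res n (a + PArc.len n (res n a) j) = j := by
  rcases len_cases (res n a) j with h | h
  · rw [h.2, res_add_n]; exact h.1
  · rw [h.2, res_gp]

theorem isChord_iff (T : Finset (PArc n)) (a b : ℤ) :
    IsChord T a b ↔ ∃ j, PArc.per (res n a) j ∈ T ∧ b = a + PArc.len n (res n a) j := by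
  constructor
  · rintro ⟨i, j, h, t, rfl, rfl⟩
    rw [res_of]
    exact ⟨j, h, rfl⟩
  · rintro ⟨j, h, hb⟩
    exact ⟨res n a, j, h, a / n, res_spec a, hb⟩

theorem isRay_iff (T : Finset (PArc n)) (a : ℤ) :
    IsRay T a ↔ PArc.spoke (res n a) ∈ T := by
  constructor
  · rintro ⟨i, h, t, rfl⟩
    rw [res_of]
    exact h
  · intro h
    exact ⟨res n a, h, a / n, res_spec a⟩

theorem ok_of (T : Finset (PArc n)) (hv : ∀ a ∈ T, PArc.Valid a)
    (hc : ∀ a ∈ T, ∀ b ∈ T, a ≠ b → ¬ PArc.Cross a b) : Ok T := by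
  have hlen : ∀ a b, IsChord T a b → a + 2 ≤ b ∧ b ≤ a + n := by
    intro a b h
    rw [isChord_iff] at h
    obtain ⟨j, h, rfl⟩ := h
    have h1 := hv _ h
    simp only [PArc.Valid] at h1
    have := len_le (res n a) j
    omega
  refine ⟨hlen, ?_, ?_⟩
  · rintro p q r s h1 h2 ⟨h3, h4, h5⟩
    have l1 := hlen _ _ h1
    have l2 := hlen _ _ h2
    rw [isChord_iff] at h1 h2
    obtain ⟨j, h1, hq⟩ := h1
    obtain ⟨l, h2, hs⟩ := h2
    have hg := gp_eq (n := n) p r (by omega) (by omega)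
    refine hc _ h1 _ h2 ?_ ?_
    · intro he
      injection he with he1 he2
      rw [← he1, gp_cast] at hg
      simp at hg
      omega
    · left
      refine ⟨by omega, by omega, by omega⟩
  · rintro x c d h1 h2 ⟨h3, h4⟩
    have l2 := hlen _ _ h2
    rw [isRay_iff] at h1
    rw [isChord_iff] at h2
    obtain ⟨j, h2, hq⟩ := h2
    have hg := gp_eq (n := n) c x (by omega) (by omega)
    refine hc _ h1 _ h2 (by simp) ?_
    refine ⟨by omega, by omega⟩

theorem of_ok (T : Finset (PArc n)) (ok : Ok T) : (∀ a ∈ T, PArc.Valid a) ∧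
    (∀ a ∈ T, ∀ b ∈ T, a ≠ b → ¬ PArc.Cross a b) := by
  have hch : ∀ (a : ℤ) (i j : Fin n), PArc.per i j ∈ T → res n a = i →
      IsChord T a (a + PArc.len n i j) := by
    rintro a i j h rfl
    rw [isChord_iff]; exact ⟨j, h, rfl⟩
  have hsp : ∀ (s i j : Fin n), PArc.spoke s ∈ T → PArc.per i j ∈ T →
      ¬ (0 < PArc.gp n i s ∧ PArc.gp n i s < PArc.len n i j) := by
    rintro s i j h1 h2 ⟨h3, h4⟩
    refine ok.ray ((i.val : ℤ) + PArc.gp n i s) _ _ ?_ (hch i.val i j h2 (res_coe i))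
      ⟨by omega, by omega⟩
    rw [isRay_iff]
    have := res_gp (n := n) i.val s
    rw [res_coe] at this
    rw [this]; exact h1
  have hpp : ∀ (i j k l : Fin n), PArc.per i j ∈ T → PArc.per k l ∈ T →
      ¬ (0 < PArc.gp n i k ∧ PArc.gp n i k < PArc.len n i j ∧
        PArc.len n i j < PArc.gp n i k + PArc.len n k l) := by
    rintro i j k l h1 h2 ⟨h3, h4, h5⟩
    have := res_gp (n := n) i.val k
    rw [res_coe] at this
    exact ok.nc _ _ _ _ (hch i.val i j h1 (res_coe i)) (hch _ k l h2 this)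
      ⟨by omega, by omega, by omega⟩
  constructor
  · rintro (i | ⟨i, j⟩) h
    · trivial
    · have := ok.len _ _ (hch i.val i j h (res_coe i))
      simp only [PArc.Valid]
      omega
  · rintro (i | ⟨i, j⟩) h1 (k | ⟨k, l⟩) h2 _ hc
    · exact hc
    · exact hsp _ _ _ h1 h2 hc
    · exact hsp _ _ _ h2 h1 hc
    · rcases hc with hc | hc
      · exact hpp _ _ _ _ h1 h2 hc
      · exact hpp _ _ _ _ h2 h1 hc

def src : PArc n → Fin n
  | .spoke i => i
  | .per i _ => i

/-- number of arcs starting at `i` -/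
def deg (T : Finset (PArc n)) (i : Fin n) : ℕ := (T.filter (fun A => src A = i)).card

theorem sum_deg (T : Finset (PArc n)) : ∑ i, deg T i = T.card := by
  unfold deg
  exact (Finset.card_eq_sum_card_fiberwise (f := src) (t := Finset.univ) (by simp)).symm

theorem dg_eq (T : Finset (PArc n)) (x : ℤ) : dg T x = deg T (res n x) := by
  classical
  unfold dg deg cnt
  let J := Finset.univ.filter (fun j : Fin n => PArc.per (res n x) j ∈ T)
  have h1 : (Finset.Icc x (x+n)).filter (IsChord T x)
      = J.image (fun j => x + (PArc.len n (res n x) j : ℤ)) := by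
    ext b
    simp only [Finset.mem_filter, Finset.mem_Icc, Finset.mem_image, J, Finset.mem_univ, true_and,
      isChord_iff]
    constructor
    · rintro ⟨_, j, h, rfl⟩; exact ⟨j, h, rfl⟩
    · rintro ⟨j, h, rfl⟩
      have := len_le (res n x) j
      exact ⟨⟨by omega, by omega⟩, j, h, rfl⟩
  have h2 : T.filter (fun A => src A = res n x) = J.image (PArc.per (res n x)) ∪
      (if IsRay T x then {PArc.spoke (res n x)} else ∅) := by
    ext A
    simp only [Finset.mem_filter, Finset.mem_union, Finset.mem_image, J, Finset.mem_univ, true_and,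
      isRay_iff]
    rcases A with i | ⟨i, j⟩
    · simp only [src]
      split_ifs with h
      · simp
        rintro rfl; exact h
      · simp
        rintro h' rfl; exact h h'
    · simp only [src]
      constructor
      · rintro ⟨h, rfl⟩
        exact Or.inl ⟨j, h, rfl⟩
      · rintro (⟨j', h, he⟩ | h)
        · injection he with e1 e2
          subst e1 e2
          exact ⟨h, rfl⟩
        · split_ifs at h <;> simp at h
  rw [h1, h2, Finset.card_union_of_disjoint, Finset.card_image_of_injective,
    Finset.card_image_of_injective]
  · split_ifs <;> simp
  · intro j j' h; injection h
  · intro j j' h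
    have h3 := res_len x j
    have h4 := res_len x j'
    simp only at h
    rw [h] at h3
    exact h3.symm.trans h4
  · rw [Finset.disjoint_left]
    intro A hA hB
    simp only [Finset.mem_image] at hA
    obtain ⟨j, _, rfl⟩ := hA
    split_ifs at hB <;> simp at hB

/-- discrete primitive -/
noncomputable def prim (f : ℤ → ℤ) (x : ℤ) : ℤ := ∑ y ∈ Finset.Ico 0 x, f y - ∑ y ∈ Finset.Ico x 0, f y

theorem prim_succ (f : ℤ → ℤ) (x : ℤ) : prim f (x+1) = prim f x + f x := by
  unfold prim
  rcases le_or_gt 0 x with h | h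
  · have h1 : Finset.Ico 0 (x+1) = insert x (Finset.Ico 0 x) := by
      ext y; simp only [Finset.mem_Ico, Finset.mem_insert]; omega
    rw [h1, Finset.sum_insert (by simp), Finset.Ico_eq_empty (by omega : ¬ x < 0),
      Finset.Ico_eq_empty (by omega : ¬ x + 1 < 0)]
    simp; ring
  · have h1 : Finset.Ico x 0 = insert x (Finset.Ico (x+1) 0) := by
      ext y; simp only [Finset.mem_Ico, Finset.mem_insert]; omega
    rw [h1, Finset.sum_insert (by simp), Finset.Ico_eq_empty (by omega : ¬ 0 < x),
      Finset.Ico_eq_empty (by omega : ¬ 0 < x + 1)]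
    simp

/-- the walk -/
noncomputable def Wk (m : ℕ) (δ : Fin n → ℕ) : ℤ → ℤ := prim (fun x => 1 - m * δ (res n x))

theorem Wk_succ (m : ℕ) (δ : Fin n → ℕ) (x : ℤ) :
    Wk m δ (x+1) = Wk m δ x + 1 - m * δ (res n x) := by
  unfold Wk; rw [prim_succ]; ring

theorem Wk_add (m : ℕ) (δ : Fin n → ℕ) (x : ℤ) :
    Wk m δ (x+n) = Wk m δ x + n - m * ∑ i, (δ i : ℤ) := by
  have hs : ∀ x, Wk m δ (x + 1 + n) - Wk m δ (x+1) = Wk m δ (x+n) - Wk m δ x := by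
    intro x
    rw [show x + 1 + (n:ℤ) = x + n + 1 by ring, Wk_succ, Wk_succ, res_add_n]; ring
  have hc : ∀ x, Wk m δ (x+n) - Wk m δ x = Wk m δ (0+n) - Wk m δ 0 := by
    intro x
    induction x using Int.induction_on with
    | zero => rfl
    | succ k ih => rw [hs, ih]
    | pred k ih => rw [← ih, ← hs]; simp
  have h0 : ∀ k : ℕ, Wk m δ k = Wk m δ 0 + ∑ y ∈ Finset.range k, (1 - m * (δ (res n y) : ℤ)) := by
    intro k
    induction k with
    | zero => simp
    | succ k ih => push_cast; rw [Wk_succ, ih, Finset.sum_range_succ]; ring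
  have h1 := hc x
  rw [zero_add, h0 n, Finset.sum_range (fun y => (1 - m * (δ (res n y) : ℤ)))] at h1
  simp only [res_coe, Finset.sum_sub_distrib, ← Finset.mul_sum] at h1
  simp at h1
  linarith

end

end PA

namespace PA

section
variable {n : ℕ} [NeZero n]

/-- first passage relation -/
def FP (m : ℕ) (δ : Fin n → ℕ) (a b : ℤ) : Prop :=
  a < b ∧ (∃ k : ℕ, 1 ≤ k ∧ k ≤ δ (res n a) ∧ Wk m δ b = Wk m δ (a+1) + m * k) ∧
    ∀ x, a < x → x < b → Wk m δ x < Wk m δ b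

open Classical in
/-- the angulation attached to `δ` -/
noncomputable def Tof (m : ℕ) (δ : Fin n → ℕ) : Finset (PArc n) :=
  (Finset.univ.filter (fun i : Fin n => ∀ x, Wk m δ x ≤ Wk m δ i.val)).image PArc.spoke ∪
  (Finset.univ.filter (fun p : Fin n × Fin n =>
    FP m δ p.1.val (p.1.val + PArc.len n p.1 p.2))).image (fun p => PArc.per p.1 p.2)

theorem spoke_mem (m : ℕ) (δ : Fin n → ℕ) (i : Fin n) :
    PArc.spoke i ∈ Tof m δ ↔ ∀ x, Wk m δ x ≤ Wk m δ i.val := by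
  simp [Tof]

theorem per_mem (m : ℕ) (δ : Fin n → ℕ) (i j : Fin n) :
    PArc.per i j ∈ Tof m δ ↔ FP m δ i.val (i.val + PArc.len n i j) := by
  simp [Tof]

theorem exists_passage (W : ℤ → ℤ) (hW : ∀ x, W (x+1) ≤ W x + 1) (a L : ℤ) (h1 : W a ≤ L)
    (h2 : ∃ y, a ≤ y ∧ L ≤ W y) : ∃ b, a ≤ b ∧ W b = L ∧ ∀ x, a ≤ x → x < b → W x < L := by
  obtain ⟨b, ⟨hb1, hb2⟩, hm⟩ := Int.exists_least_of_bdd (P := fun y => a ≤ y ∧ L ≤ W y)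
    ⟨a, fun z hz => hz.1⟩ h2
  refine ⟨b, hb1, ?_, ?_⟩
  · by_cases h : b = a
    · subst h; omega
    · have h3 := hW (b-1)
      rw [sub_add_cancel] at h3
      have h4 : ¬ (L ≤ W (b-1)) := fun h' => by
        have := hm (b-1) ⟨by omega, h'⟩; omega
      omega
  · intro x hx hxb
    by_contra hc
    have := hm x ⟨hx, by omega⟩
    omega

theorem cnt_FP (m : ℕ) (hm : 0 < m) (δ : Fin n → ℕ) (a x : ℤ) (K : ℕ) (hK : K ≤ δ (res n a))
    (hy : ∃ y, a + 1 ≤ y ∧ Wk m δ (a+1) + m * K ≤ Wk m δ y)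
    (hx : ∀ b, FP m δ a b → (b ≤ x ↔ Wk m δ b ≤ Wk m δ (a+1) + m * K)) :
    cnt (FP m δ) a x = K := by
  classical
  unfold cnt
  have hinj : Set.InjOn (Wk m δ) ((Finset.Icc a x).filter (FP m δ a) : Finset ℤ) := by
    intro b hb c hc h
    simp only [Finset.coe_filter, Set.mem_setOf_eq] at hb hc
    rcases lt_trichotomy b c with h1 | h1 | h1
    · have := hc.2.2.2 b hb.2.1 h1; omega
    · exact h1
    · have := hb.2.2.2 c hc.2.1 h1; omega
  rw [← Finset.card_image_of_injOn hinj]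
  have himg : ((Finset.Icc a x).filter (FP m δ a)).image (Wk m δ)
      = (Finset.Icc 1 K).image (fun k : ℕ => Wk m δ (a+1) + m * k) := by
    ext w
    simp only [Finset.mem_image, Finset.mem_filter, Finset.mem_Icc]
    constructor
    · rintro ⟨b, ⟨⟨h1, h2⟩, hb⟩, rfl⟩
      obtain ⟨k, hk1, hk2, hk3⟩ := hb.2.1
      refine ⟨k, ⟨hk1, ?_⟩, hk3.symm⟩
      have h3 := (hx b hb).1 h2
      rw [hk3] at h3
      have h4 : (m:ℤ) * k ≤ m * K := by omega
      have := le_of_mul_le_mul_left h4 (by omega)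
      omega
    · rintro ⟨k, ⟨hk1, hk2⟩, rfl⟩
      have hmk : (m:ℤ) * k ≤ m * K := by
        apply mul_le_mul_of_nonneg_left <;> omega
      have hmk0 : (0:ℤ) < m * k := by
        apply mul_pos <;> omega
      obtain ⟨y, hy1, hy2⟩ := hy
      obtain ⟨b, hb1, hb2, hb3⟩ := exists_passage (Wk m δ)
        (fun x => by
          rw [Wk_succ]
          have : (0:ℤ) ≤ m * δ (res n x) := by positivity
          omega)
        (a+1) (Wk m δ (a+1) + m * k) (by omega) ⟨y, hy1, by omega⟩
      have hfp : FP m δ a b := ⟨by omega, ⟨k, hk1, by omega, hb2⟩, fun x h1 h2 => by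
        rw [hb2]; exact hb3 x (by omega) h2⟩
      refine ⟨b, ⟨⟨by omega, (hx b hfp).2 (by omega)⟩, hfp⟩, hb2⟩
  rw [himg, Finset.card_image_of_injective]
  · simp
  · intro k k' h
    simp only [add_right_inj] at h
    have := mul_left_cancel₀ (by omega) h
    exact_mod_cast this

section per
variable {m ℓ : ℕ}

theorem Wk_per (hn : n = m * ℓ) (δ : Fin n → ℕ) (hδ : ∑ i, δ i = ℓ) (x : ℤ) :
    Wk m δ (x+n) = Wk m δ x := by
  rw [Wk_add]
  have : (∑ i, (δ i : ℤ)) = ℓ := by exact_mod_cast hδ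
  rw [this]
  have : (n : ℤ) = m * ℓ := by exact_mod_cast hn
  rw [this]; ring

theorem Wk_per' (hn : n = m * ℓ) (δ : Fin n → ℕ) (hδ : ∑ i, δ i = ℓ) (x t : ℤ) :
    Wk m δ (x+t*n) = Wk m δ x := by
  have h : Function.Periodic (Wk m δ) (n:ℤ) := Wk_per hn δ hδ
  have := h.int_mul t x
  simpa using this

theorem Wk_res (hn : n = m * ℓ) (δ : Fin n → ℕ) (hδ : ∑ i, δ i = ℓ) (x : ℤ) :
    Wk m δ (res n x).val = Wk m δ x := by
  conv_rhs => rw [res_spec (n := n) x, Wk_per' hn δ hδ]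

theorem FP_shift (hn : n = m * ℓ) (δ : Fin n → ℕ) (hδ : ∑ i, δ i = ℓ) (a b t : ℤ)
    (h : FP m δ a b) : FP m δ (a + t * n) (b + t * n) := by
  obtain ⟨h1, ⟨k, hk1, hk2, hk3⟩, h2⟩ := h
  refine ⟨by omega, ⟨k, hk1, by rwa [res_add], ?_⟩, ?_⟩
  · rw [show a + t * n + 1 = (a + 1) + t * n by ring, Wk_per' hn δ hδ, Wk_per' hn δ hδ, hk3]
  · intro x h3 h4
    rw [Wk_per' hn δ hδ]
    have := h2 (x - t * n) (by omega) (by omega)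
    rwa [← Wk_per' hn δ hδ _ t, sub_add_cancel] at this

theorem FP_len (hm : 0 < m) (hn : n = m * ℓ) (δ : Fin n → ℕ) (hδ : ∑ i, δ i = ℓ) (a b : ℤ)
    (h : FP m δ a b) : a + 2 ≤ b ∧ b ≤ a + n := by
  obtain ⟨h1, ⟨k, hk1, hk2, hk3⟩, h2⟩ := h
  constructor
  · have : b ≠ a + 1 := by
      rintro rfl
      have : (0:ℤ) < m * k := by apply mul_pos <;> omega
      omega
    omega
  · by_contra hc
    have h0 : 0 < n := npos
    have h3 := h2 (b - n) (by omega) (by omega)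
    have h4 := Wk_per hn δ hδ (b - n)
    rw [sub_add_cancel] at h4
    omega

theorem FP_le (δ : Fin n → ℕ) (a b : ℤ) (h : FP m δ a b) : Wk m δ b ≤ Wk m δ a + 1 := by
  obtain ⟨h1, ⟨k, hk1, hk2, hk3⟩, h2⟩ := h
  rw [hk3, Wk_succ]
  have : (m:ℤ) * k ≤ m * δ (res n a) := by
    apply mul_le_mul_of_nonneg_left <;> omega
  omega

theorem chord_Tof (hm : 0 < m) (hn : n = m * ℓ) (δ : Fin n → ℕ) (hδ : ∑ i, δ i = ℓ) :
    IsChord (Tof m δ) = FP m δ := by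
  funext a b
  apply propext
  rw [isChord_iff]
  constructor
  · rintro ⟨j, h, rfl⟩
    rw [per_mem] at h
    have := FP_shift hn δ hδ _ _ (a / n) h
    rw [← res_spec] at this
    convert this using 1
    rw [add_right_comm, ← res_spec]
  · intro h
    have hl := FP_len hm hn δ hδ a b h
    have he := len_eq (n := n) a b (by omega) (by omega)
    refine ⟨res n b, ?_, by omega⟩
    rw [per_mem, he]
    have := FP_shift hn δ hδ _ _ (-(a / n)) h
    have hs := res_spec (n := n) a
    have e1 : a + -(a / n) * n = (res n a).val := by rw [neg_mul]; omega
    rw [e1] at this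
    convert this using 1
    rw [neg_mul]; omega

theorem ray_Tof (hn : n = m * ℓ) (δ : Fin n → ℕ) (hδ : ∑ i, δ i = ℓ) (a : ℤ) :
    IsRay (Tof m δ) a ↔ ∀ x, Wk m δ x ≤ Wk m δ a := by
  rw [isRay_iff, spoke_mem, Wk_res hn δ hδ]

theorem ok_Tof (hm : 0 < m) (hn : n = m * ℓ) (δ : Fin n → ℕ) (hδ : ∑ i, δ i = ℓ) :
    Ok (Tof m δ) := by
  have hC := chord_Tof hm hn δ hδ
  refine ⟨?_, ?_, ?_⟩
  · rw [hC]; exact FP_len hm hn δ hδ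
  · rw [hC]
    rintro p q r s h1 h2 ⟨h3, h4, h5⟩
    have e1 := h1.2.2 r h3 h4
    have e2 := h2.2.2 q h4 h5
    have e3 := FP_le δ _ _ h2
    omega
  · rw [hC]
    rintro x c d hx h ⟨h1, h2⟩
    rw [ray_Tof hn δ hδ] at hx
    have := h.2.2 x h1 h2
    have := hx d
    omega

theorem exists_max (hn : n = m * ℓ) (δ : Fin n → ℕ) (hδ : ∑ i, δ i = ℓ) :
    ∃ i : Fin n, ∀ x, Wk m δ x ≤ Wk m δ i.val := by
  obtain ⟨i, hi, h⟩ := (Finset.univ : Finset (Fin n)).exists_max_image (fun i => Wk m δ i.val)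
    ⟨res n 0, Finset.mem_univ _⟩
  refine ⟨i, fun x => ?_⟩
  rw [← Wk_res hn δ hδ x]
  exact h _ (Finset.mem_univ _)

/-- positions can be shifted beyond any bound -/
theorem exists_shift (hn : n = m * ℓ) (δ : Fin n → ℕ) (hδ : ∑ i, δ i = ℓ) (x a : ℤ) :
    ∃ y, a ≤ y ∧ Wk m δ y = Wk m δ x := by
  have h0 : 0 < n := npos
  refine ⟨x + (|a - x|) * n, ?_, Wk_per' hn δ hδ _ _⟩
  have h1 : |a - x| * 1 ≤ |a - x| * n := by
    apply mul_le_mul_of_nonneg_left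
    · omega
    · exact abs_nonneg _
  have := le_abs_self (a - x)
  omega

theorem good_Tof (hm : 0 < m) (hn : n = m * ℓ) (δ : Fin n → ℕ) (hδ : ∑ i, δ i = ℓ) (a b : ℤ)
    (h : IsChord (Tof m δ) a b) : Good (IsChord (Tof m δ)) (Wk m δ) m a b := by
  rw [chord_Tof hm hn δ hδ] at h ⊢
  refine ⟨?_, h.2.2⟩
  obtain ⟨k, hk1, hk2, hk3⟩ := h.2.1
  rw [cnt_FP m hm δ a b k hk2 ⟨b, by have := h.1; omega, hk3.ge⟩, hk3]
  intro c hc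
  rw [← hk3]
  constructor
  · intro hcb
    rcases hcb.lt_or_eq with h1 | h1
    · exact (h.2.2 c hc.1 h1).le
    · rw [h1]
  · intro hw
    by_contra hcon
    have := hc.2.2 b h.1 (by omega)
    omega

theorem dg_Tof (hm : 0 < m) (hn : n = m * ℓ) (δ : Fin n → ℕ) (hδ : ∑ i, δ i = ℓ) (a : ℤ) :
    dg (Tof m δ) a = δ (res n a) := by
  unfold dg
  rw [chord_Tof hm hn δ hδ]
  obtain ⟨M, hM⟩ := exists_max hn δ hδ
  have hs := Wk_succ m δ a
  obtain ⟨y, hy1, hy2⟩ := exists_shift hn δ hδ M.val (a+1)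
  split_ifs with h
  · rw [ray_Tof hn δ hδ] at h
    have hpos : 1 ≤ δ (res n a) := by
      by_contra hc
      have h0 : δ (res n a) = 0 := by omega
      rw [h0] at hs
      have := h (a+1)
      simp at hs
      omega
    have e : (m : ℤ) * ((δ (res n a) - 1 : ℕ) : ℤ) = m * δ (res n a) - m := by
      push_cast [hpos]; ring
    rw [cnt_FP m hm δ a (a+n) (δ (res n a) - 1) (by omega)
      ⟨y, hy1, by rw [e, hs, hy2]; have := hM a; omega⟩]
    · omega
    · intro b hb
      refine ⟨fun _ => ?_, fun _ => (FP_len hm hn δ hδ a b hb).2⟩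
      obtain ⟨k, hk1, hk2, hk3⟩ := hb.2.1
      have h1 := h b
      have hk : k ≤ δ (res n a) - 1 := by
        by_contra hc
        have : k = δ (res n a) := by omega
        subst this
        omega
      rw [hk3]
      have : (m:ℤ) * k ≤ m * ((δ (res n a) - 1 : ℕ) : ℤ) := by
        apply mul_le_mul_of_nonneg_left <;> omega
      omega
  · rw [ray_Tof hn δ hδ] at h
    have hlt : Wk m δ a < Wk m δ M.val := by
      by_contra hc
      exact h (fun x => (hM x).trans (by omega))
    rw [cnt_FP m hm δ a (a+n) (δ (res n a)) le_rfl
      ⟨y, hy1, by rw [hs, hy2]; omega⟩]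
    · rfl
    · intro b hb
      refine ⟨fun _ => ?_, fun _ => (FP_len hm hn δ hδ a b hb).2⟩
      have := FP_le δ a b hb
      omega

theorem ang_Tof (hm : 0 < m) (hn : n = m * ℓ) (δ : Fin n → ℕ) (hδ : ∑ i, δ i = ℓ) :
    IsAngulation n m (Tof m δ) := by
  have ok := ok_Tof hm hn δ hδ
  have hW : ∀ x, Wk m δ (x+1) = Wk m δ x + 1 - m * dg (Tof m δ) x := by
    intro x; rw [dg_Tof hm hn δ hδ, Wk_succ]
  obtain ⟨hv, hc⟩ := of_ok _ ok
  refine ⟨hv, hc, ?_, ?_, ?_⟩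
  · obtain ⟨M, hM⟩ := exists_max hn δ hδ
    exact ⟨M, (spoke_mem m δ M).2 hM⟩
  · exact card_of_good ok (Wk m δ) m hW (good_Tof hm hn δ hδ)
  · intro a b ha hb hab hno
    have h1 := (pun_lemma ok hab ha hb hno (Wk m δ) m hW (good_Tof hm hn δ hδ)).1
    rw [ray_Tof hn δ hδ] at ha hb
    have := ha b
    have := hb a
    omega

theorem ang_sub (hn : n = m * ℓ) (hm : 0 < m) (T : Finset (PArc n)) (h : IsAngulation n m T) :
    ∑ i, deg T i = ℓ ∧ T ⊆ Tof m (deg T) := by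
  obtain ⟨hv, hc, ⟨s, hs⟩, hfin, hpun⟩ := h
  have ok := ok_of T hv hc
  have hW : ∀ x, Wk m (deg T) (x+1) = Wk m (deg T) x + 1 - m * dg T x := by
    intro x; rw [dg_eq, Wk_succ]
  have hg := good_of_ang ok (Wk m (deg T)) m hW hfin
  have hmax := ray_max (n := n) npos (T := T) (Wk m (deg T))
    (fun x hx => by rw [isRay_iff] at hx ⊢; rwa [res_add_n])
    (fun a b ha hb hab hno => by
      have h1 := pun_lemma ok hab ha hb hno (Wk m (deg T)) m hW hg
      rw [hpun a b ha hb hab hno] at h1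
      refine ⟨?_, h1.2⟩
      rw [h1.1]; push_cast; ring)
  have hray : ∀ i : Fin n, PArc.spoke i ∈ T → IsRay T i.val := by
    intro i hi; rw [isRay_iff, res_coe]; exact hi
  have hsum : ∑ i, deg T i = ℓ := by
    have h1 := (hmax s.val (hray s hs) n).2 (by
      have := hray s hs
      rw [isRay_iff] at this ⊢; rwa [res_add_n])
    rw [Wk_add] at h1
    have h2 : (m : ℤ) * ∑ i, (deg T i : ℤ) = m * ℓ := by
      have : (n : ℤ) = m * ℓ := by exact_mod_cast hn
      linarith
    have := mul_left_cancel₀ (by omega) h2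
    exact_mod_cast this
  refine ⟨hsum, ?_⟩
  rintro (i | ⟨i, j⟩) hi
  · rw [spoke_mem]
    intro x
    obtain ⟨y, hy1, hy2⟩ := exists_shift hn (deg T) hsum x i.val
    have := (hmax i.val (hray i hi) (y - i.val).toNat).1
    rw [show (i.val : ℤ) + ((y - i.val).toNat : ℤ) = y by omega] at this
    omega
  · rw [per_mem]
    have hch : IsChord T i.val (i.val + PArc.len n i j) := by
      rw [isChord_iff, res_coe]; exact ⟨j, hi, rfl⟩
    have hl := ok.len _ _ hch
    have h1 := hg _ _ hch
    refine ⟨by omega, ⟨_, ?_, ?_, h1.1⟩, h1.2⟩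
    · unfold cnt
      apply Finset.card_pos.2
      exact ⟨_, by
        classical
        rw [Finset.mem_filter]
        exact ⟨Finset.mem_Icc.2 ⟨by omega, le_rfl⟩, hch⟩⟩
    · rw [← dg_eq]
      unfold dg
      refine le_trans ?_ (Nat.le_add_right _ _)
      unfold cnt
      apply Finset.card_le_card
      classical
      apply Finset.filter_subset_filter
      apply Finset.Icc_subset_Icc le_rfl hl.2

theorem deg_Tof (hm : 0 < m) (hn : n = m * ℓ) (δ : Fin n → ℕ) (hδ : ∑ i, δ i = ℓ) :
    deg (Tof m δ) = δ := by
  funext i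
  have := dg_Tof hm hn δ hδ i.val
  rw [dg_eq, res_coe] at this
  exact this

theorem eq_Tof (hm : 0 < m) (hn : n = m * ℓ) (T : Finset (PArc n)) (h : IsAngulation n m T) :
    T = Tof m (deg T) := by
  obtain ⟨h1, h2⟩ := ang_sub hn hm T h
  apply Finset.eq_of_subset_of_card_le h2
  rw [← sum_deg, ← sum_deg, deg_Tof hm hn _ h1]

theorem main (hm : 0 < m) (hn : n = m * ℓ) :
    Nat.card {T : Finset (PArc n) // IsAngulation n m T} = Nat.choose (n + ℓ - 1) ℓ := by
  classical
  have e : {T : Finset (PArc n) // IsAngulation n m T} ≃ {δ : Fin n → ℕ // ∑ i, δ i = ℓ} :=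
    { toFun := fun T => ⟨deg T.1, (ang_sub hn hm T.1 T.2).1⟩
      invFun := fun δ => ⟨Tof m δ.1, ang_Tof hm hn δ.1 δ.2⟩
      left_inv := fun T => Subtype.ext (eq_Tof hm hn T.1 T.2).symm
      right_inv := fun δ => Subtype.ext (deg_Tof hm hn δ.1 δ.2) }
  rw [Nat.card_congr e, Nat.card_congr (Sym.equivNatSumOfFintype (Fin n) ℓ).symm,
    Nat.card_eq_fintype_card, Sym.card_sym_eq_choose, Fintype.card_fin]

end per

end

end PA

/-- for `n = mℓ`, the total number of `(m+2)`-angulations of the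
once-punctured `n`-gon is `C(n+ℓ-1, ℓ)`; in particular for `m = 1` the number of
triangulations of `P_n^•` is `C(2n-1, n)`. -/
theorem stmt11 (m ℓ : ℕ) (hm : 0 < m) (hl : 0 < ℓ) :
    Nat.card {T : Finset (PArc (m * ℓ)) // IsAngulation (m * ℓ) m T}
      = Nat.choose (m * ℓ + ℓ - 1) ℓ := by
  haveI : NeZero (m * ℓ) := ⟨(Nat.mul_pos hm hl).ne'⟩
  exact PA.main hm rfl
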